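/- arXiv:1401.6518 — 16 statements merged into one kernel-verified Lean document; each statement's English description precedes it below -/
import Mathlib

section
/- Let S be a semigroup, let n ≥ 1 be a natural number, let A, B ⊆ S, and let ℱ₁, …, ℱ_k be families of functions from Sⁿ to S. If A is (ℱ₁ ∪ ⋯ ∪ ℱ_k)-finitely embeddable in B, then there exists an index i ≤ k such that A is ℱᵢ-finitely embeddable in B. -/
/-- `A` is `F`-finitely embeddable in `B`: for every finite subset `G` of `A` there is
`f ∈ F` such that `f(Gⁿ) ⊆ B`. -/
def FinEmb {S : Type*} (n : ℕ) (F : Set ((Fin n → S) → S)) (A B : Set S) : Prop :=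
  ∀ G : Finset S, ↑G ⊆ A → ∃ f ∈ F, ∀ a : Fin n → S, (∀ i, a i ∈ G) → f a ∈ B

theorem stmt_0 {S : Type*} [Semigroup S] (n : ℕ) (hn : 1 ≤ n) (k : ℕ) (hk : 1 ≤ k)
    (F : Fin k → Set ((Fin n → S) → S)) (A B : Set S)
    (h : FinEmb n (⋃ i, F i) A B) :
    ∃ i : Fin k, FinEmb n (F i) A B := by
  classical
  by_contra! hc
  simp only [FinEmb, not_forall] at hc
  choose G hG hbad using hc
  obtain ⟨f, hf, hfB⟩ := h (Finset.univ.biUnion G) (by simpa using hG)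
  obtain ⟨i, hi⟩ := Set.mem_iUnion.mp hf
  exact hbad i ⟨f, hi, fun a ha => hfB a fun j =>
    Finset.mem_biUnion.mpr ⟨i, Finset.mem_univ i, ha j⟩⟩
end

section
/- Let S be a semigroup, let n ≥ 1 be a natural number, and let ℱ be a family of functions from Sⁿ to S. The relation ≤_ℱ on subsets of S is transitive if and only if for every finite subset F of S and all functions f, g ∈ ℱ there exists a function h ∈ ℱ such that h(Fⁿ) ⊆ g([f(Fⁿ)]ⁿ), where for a set X ⊆ S, g(Xⁿ) denotes {g(x₁,…,xₙ) : x₁,…,xₙ ∈ X}. -/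
/-- For `X ⊆ S`, `nApp n f X = f(Xⁿ) = {f(x₁,…,xₙ) : x₁,…,xₙ ∈ X}`. -/
def nApp {S : Type*} (n : ℕ) (f : (Fin n → S) → S) (X : Set S) : Set S :=
  f '' {a : Fin n → S | ∀ i, a i ∈ X}

theorem nApp_subset_iff {S : Type*} {n : ℕ} {f : (Fin n → S) → S} {X Y : Set S} :
    nApp n f X ⊆ Y ↔ ∀ a : Fin n → S, (∀ i, a i ∈ X) → f a ∈ Y :=
  Set.image_subset_iff

theorem nApp_mono {S : Type*} {n : ℕ} (f : (Fin n → S) → S) {X Y : Set S} (h : X ⊆ Y) :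
    nApp n f X ⊆ nApp n f Y :=
  Set.image_mono fun _ ha i => h (ha i)

theorem Set.Finite.nApp {S : Type*} {n : ℕ} (f : (Fin n → S) → S) {X : Set S} (hX : X.Finite) :
    (nApp n f X).Finite :=
  (Set.Finite.pi' fun _ => hX).image f

theorem finEmb_iff {S : Type*} {n : ℕ} {F : Set ((Fin n → S) → S)} {A B : Set S} :
    FinEmb n F A B ↔ ∀ G : Finset S, ↑G ⊆ A → ∃ f ∈ F, nApp n f ↑G ⊆ B := by
  simp only [FinEmb, nApp_subset_iff, Finset.mem_coe]

theorem finEmb_nApp {S : Type*} {n : ℕ} {F : Set ((Fin n → S) → S)} {f : (Fin n → S) → S}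
    (hf : f ∈ F) (A : Set S) : FinEmb n F A (nApp n f A) :=
  finEmb_iff.2 fun _ hG => ⟨f, hf, nApp_mono f hG⟩

theorem stmt_1 {S : Type*} [Semigroup S] (n : ℕ) (hn : 1 ≤ n)
    (F : Set ((Fin n → S) → S)) :
    (∀ A B C : Set S, FinEmb n F A B → FinEmb n F B C → FinEmb n F A C) ↔
    (∀ G : Finset S, ∀ f ∈ F, ∀ g ∈ F, ∃ h ∈ F,
      nApp n h ↑G ⊆ nApp n g (nApp n f ↑G)) := by
  constructor
  · intro htrans G f hf g hg
    exact finEmb_iff.1 (htrans _ _ _ (finEmb_nApp hf ↑G) (finEmb_nApp hg _)) G subset_rfl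
  · intro hcomp A B C hAB hBC
    rw [finEmb_iff] at *
    intro G hG
    obtain ⟨f, hf, hfB⟩ := hAB G hG
    have hfin : (nApp n f ↑G).Finite := G.finite_toSet.nApp f
    obtain ⟨g, hg, hgC⟩ := hBC hfin.toFinset (by rwa [hfin.coe_toFinset])
    rw [hfin.coe_toFinset] at hgC
    obtain ⟨h, hh, hsub⟩ := hcomp G f hf g hg
    exact ⟨h, hh, hsub.trans hgC⟩
end

section
/- Let S be a semigroup, let b ≥ 1 be a natural number, and suppose S is b-weakly left cancellative, i.e. for all x, y ∈ S the set {s ∈ S : s·x = y} has at most b elements. Let (D,≤) be a nonempty upward directed set and let ⟨F_d⟩_{d∈D} be a monotone net of nonempty finite subsets of S (F_d ⊆ F_e whenever d ≤ e). If A, B ⊆ S and A is ℱ^R_{(S,·)}-finitely embeddable in B, then d*_F(A) ≤ b · d*_F(B). -/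
/-- The density `d*_F(A)` of `A ⊆ S` with respect to the net `Fnet` of finite subsets of `S`. -/
noncomputable def dens {S : Type*} [Mul S] {D : Type*} [Preorder D]
    (Fnet : D → Finset S) (A : Set S) : ℝ :=
  sSup {α : ℝ | ∀ m : D, ∃ n : D, m ≤ n ∧
    (((A ∩ ↑(Fnet n)).ncard : ℝ) ≥ α * (Fnet n).card ∨
      ∃ x : S, ((A ∩ ((· * x) '' ↑(Fnet n))).ncard : ℝ) ≥ α * (Fnet n).card)}

/-- Right translation of a finite set shrinks its size by at most the bound on the fibres. -/
theorem Set.ncard_le_mul_ncard_of_mul_right_mem {S : Type*} [Mul S] {b : ℕ}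
    (hcanc : ∀ x y : S, ∃ t : Finset S, {s : S | s * x = y} ⊆ ↑t ∧ t.card ≤ b)
    {G T : Set S} (hG : G.Finite) (hT : T.Finite) {r : S} (h : ∀ a ∈ G, a * r ∈ T) :
    G.ncard ≤ b * T.ncard := by
  classical
  rw [Set.ncard_eq_toFinset_card G hG, Set.ncard_eq_toFinset_card T hT]
  refine Finset.card_le_mul_card_image_of_maps_to (f := (· * r)) ?_ b ?_
  · simpa using h
  · intro y _
    obtain ⟨t, ht, htb⟩ := hcanc r y
    refine (Finset.card_le_card fun s hs => ?_).trans htb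
    exact ht (Finset.mem_filter.mp hs).2

/-- The set of lower density bounds whose supremum is `dens` is bounded above by `1`. -/
theorem dens_bound_le_one {S D : Type*} [Mul S] [Preorder D] [Nonempty D]
    {Fnet : D → Finset S} (hne : ∀ d : D, (Fnet d).Nonempty) {A : Set S} {α : ℝ}
    (hα : ∀ m : D, ∃ n : D, m ≤ n ∧
      (((A ∩ ↑(Fnet n)).ncard : ℝ) ≥ α * (Fnet n).card ∨
        ∃ x : S, ((A ∩ ((· * x) '' ↑(Fnet n))).ncard : ℝ) ≥ α * (Fnet n).card)) :
    α ≤ 1 := by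
  obtain ⟨n, -, h⟩ := hα (Classical.arbitrary D)
  have hpos : (0 : ℝ) < (Fnet n).card := by exact_mod_cast (hne n).card_pos
  refine le_of_mul_le_mul_right ?_ hpos
  rw [one_mul]
  rcases h with h | ⟨x, h⟩
  · refine h.le.trans ?_
    have := Set.ncard_le_ncard (Set.inter_subset_right (s := A)) (Fnet n).finite_toSet
    rw [Set.ncard_coe_finset] at this
    exact_mod_cast this
  · refine h.le.trans ?_
    have h₁ := Set.ncard_le_ncard (Set.inter_subset_right (s := A))
      ((Fnet n).finite_toSet.image (· * x))
    have h₂ := Set.ncard_image_le (f := (· * x)) (Fnet n).finite_toSet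
    rw [Set.ncard_coe_finset] at h₂
    exact_mod_cast h₁.trans h₂

theorem stmt_2 {S D : Type*} [Semigroup S] [Preorder D] [Nonempty D]
    (hdir : ∀ a b : D, ∃ c : D, a ≤ c ∧ b ≤ c)
    (Fnet : D → Finset S) (hne : ∀ d : D, (Fnet d).Nonempty)
    (hmono : ∀ d e : D, d ≤ e → Fnet d ⊆ Fnet e)
    (b : ℕ) (hb : 1 ≤ b)
    (hcanc : ∀ x y : S, ∃ t : Finset S, {s : S | s * x = y} ⊆ ↑t ∧ t.card ≤ b)
    (A B : Set S)
    (hAB : ∀ G : Finset S, ↑G ⊆ A → ∃ r : S, ∀ a ∈ G, a * r ∈ B) :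
    dens Fnet A ≤ (b : ℝ) * dens Fnet B := by
  have hb' : (0 : ℝ) < b := by exact_mod_cast hb
  have translate (G : Set S) (hGA : G ⊆ A) (hG : G.Finite) :
      ∃ r : S, ∀ T : Set S, T.Finite → (∀ a ∈ G, a * r ∈ T) →
        (G.ncard : ℝ) ≤ b * (B ∩ T).ncard := by
    obtain ⟨r, hr⟩ := hAB hG.toFinset (by simpa using hGA)
    refine ⟨r, fun T hT hGT => ?_⟩
    exact_mod_cast Set.ncard_le_mul_ncard_of_mul_right_mem hcanc hG (hT.inter_of_right B)
      fun a ha => ⟨hr a (hG.mem_toFinset.mpr ha), hGT a ha⟩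
  refine csSup_le ⟨0, fun m => ⟨m, le_rfl, Or.inl (by simp)⟩⟩ fun α hα => ?_
  rw [← div_le_iff₀' hb']
  refine le_csSup ⟨1, fun _ h => dens_bound_le_one hne h⟩ fun m => ?_
  obtain ⟨n, hmn, h⟩ := hα m
  have key : ∃ x : S, α * (Fnet n).card ≤ b * (B ∩ ((· * x) '' ↑(Fnet n))).ncard := by
    have hfin (x : S) : ((· * x) '' (Fnet n : Set S)).Finite := (Fnet n).finite_toSet.image _
    rcases h with h | ⟨x, h⟩
    · obtain ⟨r, hr⟩ := translate _ Set.inter_subset_left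
        ((Fnet n).finite_toSet.inter_of_right A)
      exact ⟨r, h.le.trans (hr _ (hfin r) fun a ha => ⟨a, ha.2, rfl⟩)⟩
    · obtain ⟨r, hr⟩ := translate _ Set.inter_subset_left ((hfin x).inter_of_right A)
      refine ⟨x * r, h.le.trans (hr _ (hfin (x * r)) ?_)⟩
      rintro _ ⟨-, c, hc, rfl⟩
      exact ⟨c, hc, (mul_assoc c x r).symm⟩
  obtain ⟨x, hx⟩ := key
  refine ⟨n, hmn, Or.inr ⟨x, ?_⟩⟩
  rw [ge_iff_le, div_mul_eq_mul_div, div_le_iff₀' hb']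
  exact hx
end

section
/- Let S be a semigroup, let b ≥ 1 be a natural number, and suppose S is b-weakly left cancellative, i.e. for all x, y ∈ S the set {s ∈ S : s·x = y} has at most b elements. Let (D,≤) be a nonempty upward directed set and let ⟨F_d⟩_{d∈D} be a monotone net of nonempty finite subsets of S (F_d ⊆ F_e whenever d ≤ e). If T ⊆ S is thick, then d*_F(T) ≥ 1/b. -/
/-- `T` is thick in `S`: every finite subset has a right translate inside `T`. -/
def Thick {S : Type*} [Mul S] (T : Set S) : Prop :=
  ∀ G : Finset S, ∃ s : S, ∀ t ∈ G, t * s ∈ T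

theorem ncard_inter_image_le {S R : Type*} (f : S → R) (F : Finset S) (A : Set R) :
    (A ∩ f '' ↑F).ncard ≤ F.card := by
  have hfin : (F : Set S).Finite := F.finite_toSet
  calc (A ∩ f '' ↑F).ncard ≤ (f '' ↑F).ncard :=
        Set.ncard_le_ncard Set.inter_subset_right (hfin.image f)
    _ ≤ (F : Set S).ncard := Set.ncard_image_le hfin
    _ = F.card := Set.ncard_coe_finset F

theorem bddAbove_dens_set {S D : Type*} [Mul S] [Preorder D] [Nonempty D]
    (Fnet : D → Finset S) (hne : ∀ d : D, (Fnet d).Nonempty) (A : Set S) :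
    BddAbove {α : ℝ | ∀ m : D, ∃ n : D, m ≤ n ∧
      (((A ∩ ↑(Fnet n)).ncard : ℝ) ≥ α * (Fnet n).card ∨
        ∃ x : S, ((A ∩ ((· * x) '' ↑(Fnet n))).ncard : ℝ) ≥ α * (Fnet n).card)} := by
  refine ⟨1, fun α hα => ?_⟩
  obtain ⟨n, -, h⟩ := hα (Classical.arbitrary D)
  have hpos : (0 : ℝ) < (Fnet n).card := by exact_mod_cast (hne n).card_pos
  refine le_of_mul_le_mul_right ?_ hpos
  rw [one_mul]
  rcases h with h | ⟨x, h⟩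
  · have hle := ncard_inter_image_le id (Fnet n) A
    rw [Set.image_id] at hle
    exact h.le.trans (by exact_mod_cast hle)
  · exact h.le.trans (by exact_mod_cast ncard_inter_image_le (· * x) (Fnet n) A)

theorem card_le_mul_ncard_image_mul_right {S : Type*} [Mul S] {b : ℕ}
    (hcanc : ∀ x y : S, ∃ t : Finset S, {s : S | s * x = y} ⊆ ↑t ∧ t.card ≤ b)
    (F : Finset S) (x : S) :
    F.card ≤ b * ((· * x) '' (F : Set S)).ncard := by
  classical
  rw [← Finset.coe_image, Set.ncard_coe_finset]
  refine Finset.card_le_mul_card_image F b fun y _ => ?_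
  obtain ⟨t, hsub, hcard⟩ := hcanc x y
  exact (Finset.card_le_card fun s hs => hsub (Finset.mem_filter.mp hs).2).trans hcard

theorem stmt_3 {S D : Type*} [Semigroup S] [Preorder D] [Nonempty D]
    (hdir : ∀ a b : D, ∃ c : D, a ≤ c ∧ b ≤ c)
    (Fnet : D → Finset S) (hne : ∀ d : D, (Fnet d).Nonempty)
    (hmono : ∀ d e : D, d ≤ e → Fnet d ⊆ Fnet e)
    (b : ℕ) (hb : 1 ≤ b)
    (hcanc : ∀ x y : S, ∃ t : Finset S, {s : S | s * x = y} ⊆ ↑t ∧ t.card ≤ b)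
    (T : Set S) (hT : Thick T) :
    dens Fnet T ≥ 1 / (b : ℝ) := by
  refine le_csSup (bddAbove_dens_set Fnet hne T) fun m => ?_
  obtain ⟨s, hs⟩ := hT (Fnet m)
  refine ⟨m, le_rfl, Or.inr ⟨s, ?_⟩⟩
  have hsub : (· * s) '' (Fnet m : Set S) ⊆ T := by
    rintro _ ⟨t, ht, rfl⟩
    exact hs t ht
  have hb' : (0 : ℝ) < b := by exact_mod_cast hb
  rw [Set.inter_eq_right.mpr hsub, ge_iff_le, one_div_mul_eq_div, div_le_iff₀' hb']
  exact_mod_cast card_le_mul_ncard_image_mul_right hcanc (Fnet m) s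
end

section
/- Let S be a semigroup, let n ≥ 1 be a natural number, let 𝒰 and 𝒱 be ultrafilters on S, and let ℱ₁, ℱ₂ be families of functions from Sⁿ to S. Then 𝒰 ≤_{ℱ₁∪ℱ₂} 𝒱 if and only if 𝒰 ≤_{ℱ₁} 𝒱 or 𝒰 ≤_{ℱ₂} 𝒱. -/
/-- `U` is `F`-finitely embeddable in `V`: for every `B ∈ V` there is `A ∈ U` with `A ≤_F B`. -/
def UFinEmb {S : Type*} (n : ℕ) (F : Set ((Fin n → S) → S)) (U V : Ultrafilter S) : Prop :=
  ∀ B ∈ V, ∃ A ∈ U, FinEmb n F A B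

theorem FinEmb.mono {S : Type*} {n : ℕ} {F F' : Set ((Fin n → S) → S)} {A B B' : Set S}
    (h : FinEmb n F A B) (hF : F ⊆ F') (hB : B ⊆ B') : FinEmb n F' A B' := by
  intro G hG
  obtain ⟨f, hf, hfB⟩ := h G hG
  exact ⟨f, hF hf, fun a ha => hB (hfB a ha)⟩

theorem FinEmb.of_union {S : Type*} {n : ℕ} {F₁ F₂ : Set ((Fin n → S) → S)} {A B : Set S}
    (h : FinEmb n (F₁ ∪ F₂) A B) : FinEmb n F₁ A B ∨ FinEmb n F₂ A B := by
  classical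
  by_contra! hcon
  simp only [FinEmb, not_forall] at hcon
  obtain ⟨⟨G₁, hG₁, h₁⟩, ⟨G₂, hG₂, h₂⟩⟩ := hcon
  obtain ⟨f, hf | hf, hfB⟩ := h (G₁ ∪ G₂) (by
    rw [Finset.coe_union]
    exact Set.union_subset hG₁ hG₂)
  · exact h₁ ⟨f, hf, fun a ha => hfB a fun i => Finset.mem_union_left _ (ha i)⟩
  · exact h₂ ⟨f, hf, fun a ha => hfB a fun i => Finset.mem_union_right _ (ha i)⟩

theorem UFinEmb.mono {S : Type*} {n : ℕ} {F F' : Set ((Fin n → S) → S)} {U V : Ultrafilter S}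
    (h : UFinEmb n F U V) (hF : F ⊆ F') : UFinEmb n F' U V := by
  intro B hB
  obtain ⟨A, hA, hAB⟩ := h B hB
  exact ⟨A, hA, hAB.mono hF subset_rfl⟩

theorem stmt_4 {S : Type*} [Semigroup S] (n : ℕ) (hn : 1 ≤ n)
    (F₁ F₂ : Set ((Fin n → S) → S)) (U V : Ultrafilter S) :
    UFinEmb n (F₁ ∪ F₂) U V ↔ UFinEmb n F₁ U V ∨ UFinEmb n F₂ U V := by
  refine ⟨fun h => ?_, fun h => h.elim (fun h => h.mono Set.subset_union_left)
    fun h => h.mono Set.subset_union_right⟩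
  by_contra! hcon
  simp only [UFinEmb, not_forall] at hcon
  obtain ⟨⟨B₁, hB₁, h₁⟩, ⟨B₂, hB₂, h₂⟩⟩ := hcon
  obtain ⟨A, hA, hAB⟩ := h (B₁ ∩ B₂) (Filter.inter_mem hB₁ hB₂)
  rcases hAB.of_union with hF | hF
  · exact h₁ ⟨A, hA, hF.mono subset_rfl Set.inter_subset_left⟩
  · exact h₂ ⟨A, hA, hF.mono subset_rfl Set.inter_subset_right⟩
end

section
/- Let S be a semigroup, let n ≥ 1 be a natural number, and let ℱ be a family of functions from Sⁿ to S. The following are equivalent: (i) every principal ultrafilter on S is ℱ-finitely embeddable in every nonprincipal ultrafilter on S; (ii) for every element s ∈ S and every infinite subset A of S there exists a function f ∈ ℱ such that f(s, s, …, s) ∈ A. -/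
theorem stmt_6 {S : Type*} [Semigroup S] (n : ℕ) (hn : 1 ≤ n)
    (F : Set ((Fin n → S) → S)) :
    (∀ s : S, ∀ V : Ultrafilter S, (∀ x : S, V ≠ (pure x : Ultrafilter S)) →
        UFinEmb n F (pure s : Ultrafilter S) V) ↔
    (∀ s : S, ∀ A : Set S, A.Infinite → ∃ f ∈ F, f (fun _ => s) ∈ A) := by
  constructor
  · intro h s A hA
    have := hA.cofinite_inf_principal_neBot
    have hV := Ultrafilter.of_le (Filter.cofinite ⊓ Filter.principal A)
    obtain ⟨X, hX, hXA⟩ := h s (Ultrafilter.of (Filter.cofinite ⊓ Filter.principal A))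
      (fun x hx => by
        have hmem := (hV.trans inf_le_left) (Set.finite_singleton x).compl_mem_cofinite
        rw [hx] at hmem
        exact Ultrafilter.mem_pure.mp hmem rfl)
      A (hV.trans inf_le_right (Filter.mem_principal_self A))
    obtain ⟨f, hf, hfA⟩ := hXA {s} (by simpa using hX)
    exact ⟨f, hf, hfA _ (by simp)⟩
  · intro h s V hV B hB
    have hinf : B.Infinite := fun hfin => by
      obtain ⟨x, -, hx⟩ := Ultrafilter.eq_pure_of_finite_mem hfin hB
      exact hV x hx
    obtain ⟨f, hf, hfB⟩ := h s B hinf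
    refine ⟨{s}, Ultrafilter.mem_pure.mpr rfl, fun G hG => ⟨f, hf, fun a ha => ?_⟩⟩
    rwa [show a = fun _ => s from funext fun i => hG (ha i)]
end

section
/- Let S be a nonempty semigroup, let n ≥ 1 be a natural number, and let ℱ be a family of functions from Sⁿ to S such that the relation ≤_ℱ on subsets of S is transitive. Let (I,≤) be a linearly ordered set and let ⟨𝒰_i⟩_{i∈I} be a family of ultrafilters on S such that 𝒰_i ≤_ℱ 𝒰_j whenever i ≤ j. Then there exists an ultrafilter 𝒰 on S such that 𝒰_i ≤_ℱ 𝒰 for every i ∈ I. -/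
theorem stmt_7 {S : Type*} [Semigroup S] [Nonempty S] (n : ℕ) (hn : 1 ≤ n)
    (F : Set ((Fin n → S) → S))
    (htrans : ∀ A B C : Set S, FinEmb n F A B → FinEmb n F B C → FinEmb n F A C)
    {I : Type*} [LinearOrder I] (U : I → Ultrafilter S)
    (hchain : ∀ i j : I, i ≤ j → UFinEmb n F (U i) (U j)) :
    ∃ W : Ultrafilter S, ∀ i : I, UFinEmb n F (U i) W := by
  rcases isEmpty_or_nonempty I with hI | hI
  · exact ⟨pure (Classical.arbitrary S), fun i => hI.elim i⟩
  · let G : Ultrafilter I := Ultrafilter.of Filter.atTop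
    refine ⟨G.bind U, fun i B hB => ?_⟩
    have hB' : ∀ᶠ j in (G : Filter I), B ∈ U j := hB
    have hi : ∀ᶠ j in (G : Filter I), i ≤ j :=
      Ultrafilter.of_le Filter.atTop (Filter.eventually_ge_atTop i)
    obtain ⟨j, hBj, hij⟩ := (hB'.and hi).exists
    exact hchain i j hij B hBj
end

section
/- Let S be a nonempty semigroup, let n ≥ 1 be a natural number, and let ℱ be a family of functions from Sⁿ to S such that the relation ≤_ℱ on subsets of S is both transitive and reflexive. Then there exists a weakly maximal ultrafilter, i.e. an ultrafilter 𝒰 on S such that for every ultrafilter 𝒱 on S, if 𝒰 ≤_ℱ 𝒱 then 𝒱 ≤_ℱ 𝒰. -/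
theorem UFinEmb.refl {S : Type*} {n : ℕ} {F : Set ((Fin n → S) → S)}
    (hrefl : ∀ A : Set S, FinEmb n F A A) (U : Ultrafilter S) : UFinEmb n F U U :=
  fun B hB => ⟨B, hB, hrefl B⟩

theorem UFinEmb.trans {S : Type*} {n : ℕ} {F : Set ((Fin n → S) → S)}
    (htrans : ∀ A B C : Set S, FinEmb n F A B → FinEmb n F B C → FinEmb n F A C)
    {U V W : Ultrafilter S} (hUV : UFinEmb n F U V) (hVW : UFinEmb n F V W) :
    UFinEmb n F U W := by
  intro C hC
  obtain ⟨B, hB, hBC⟩ := hVW C hC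
  obtain ⟨A, hA, hAB⟩ := hUV B hB
  exact ⟨A, hA, htrans A B C hAB hBC⟩

/-- Every chain of ultrafilters for `UFinEmb` has an upper bound: any ultrafilter refining the
filter of sets that eventually belong to the members of the chain. -/
theorem UFinEmb.exists_upper_bound_of_isChain {S : Type*} [Nonempty S] {n : ℕ}
    {F : Set ((Fin n → S) → S)}
    (htrans : ∀ A B C : Set S, FinEmb n F A B → FinEmb n F B C → FinEmb n F A C)
    (hrefl : ∀ A : Set S, FinEmb n F A A) {c : Set (Ultrafilter S)}
    (hc : IsChain (UFinEmb n F) c) : ∃ W : Ultrafilter S, ∀ U ∈ c, UFinEmb n F U W := by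
  rcases c.eq_empty_or_nonempty with rfl | ⟨U₀, hU₀⟩
  · exact ⟨pure (Classical.arbitrary S), fun U hU => hU.elim⟩
  let L : Filter S :=
    { sets := {B | ∃ U ∈ c, ∀ V ∈ c, UFinEmb n F U V → B ∈ V}
      univ_sets := ⟨U₀, hU₀, fun V _ _ => Filter.univ_mem⟩
      sets_of_superset := by
        rintro A B ⟨U, hU, h⟩ hAB
        exact ⟨U, hU, fun V hV hUV => Filter.mem_of_superset (h V hV hUV) hAB⟩
      inter_sets := by
        rintro A B ⟨U, hU, hA⟩ ⟨V, hV, hB⟩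
        have key : UFinEmb n F U V ∨ UFinEmb n F V U := by
          by_cases hUV : U = V
          · exact Or.inl (hUV ▸ UFinEmb.refl hrefl U)
          · exact hc hU hV hUV
        rcases key with h | h
        · exact ⟨V, hV, fun W hW hVW =>
            Filter.inter_mem (hA W hW (h.trans htrans hVW)) (hB W hW hVW)⟩
        · exact ⟨U, hU, fun W hW hUW =>
            Filter.inter_mem (hA W hW hUW) (hB W hW (h.trans htrans hUW))⟩ }
  have hL : L.NeBot := by
    refine ⟨fun h => ?_⟩
    obtain ⟨U, hU, hempty⟩ : ∅ ∈ L := Filter.empty_mem_iff_bot.mpr h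
    exact U.empty_notMem (hempty U hU (UFinEmb.refl hrefl U))
  refine ⟨Ultrafilter.of L, fun U hU B hB => ?_⟩
  by_contra hno
  have hcompl : Bᶜ ∈ L :=
    ⟨U, hU, fun V _ hUV => Ultrafilter.compl_mem_iff_notMem.mpr fun hBV => hno (hUV B hBV)⟩
  exact Ultrafilter.compl_mem_iff_notMem.mp (Ultrafilter.of_le L hcompl) hB

theorem stmt_8 {S : Type*} [Semigroup S] [Nonempty S] (n : ℕ) (hn : 1 ≤ n)
    (F : Set ((Fin n → S) → S))
    (htrans : ∀ A B C : Set S, FinEmb n F A B → FinEmb n F B C → FinEmb n F A C)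
    (hrefl : ∀ A : Set S, FinEmb n F A A) :
    ∃ U : Ultrafilter S, ∀ V : Ultrafilter S, UFinEmb n F U V → UFinEmb n F V U := by
  exact exists_maximal_of_chains_bounded
    (fun _ hc => UFinEmb.exists_upper_bound_of_isChain htrans hrefl hc)
    (fun hUV hVW => hUV.trans htrans hVW)
end

section
/- Let S be a semigroup and let 𝒰, 𝒱 be ultrafilters on S. Then 𝒰 is ℱ^R_{(S,·)}-finitely embeddable in 𝒰 ⊙ 𝒱, and 𝒱 is ℱ^L_{(S,·)}-finitely embeddable in 𝒰 ⊙ 𝒱. -/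
/-- `A` is `F`-finitely embeddable in `B` for a family `F` of unary functions. -/
def FinEmb1 {S : Type*} (F : Set (S → S)) (A B : Set S) : Prop :=
  ∀ G : Finset S, ↑G ⊆ A → ∃ f ∈ F, ∀ a ∈ G, f a ∈ B

/-- `U` is `F`-finitely embeddable in `V`. -/
def UFinEmb1 {S : Type*} (F : Set (S → S)) (U V : Ultrafilter S) : Prop :=
  ∀ B ∈ V, ∃ A ∈ U, FinEmb1 F A B

/-- The extension `U ⊙ V` of the semigroup operation to ultrafilters:
`A ∈ U ⊙ V ↔ {s | {r | s·r ∈ A} ∈ V} ∈ U`. -/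
def umul {S : Type*} [Semigroup S] (U V : Ultrafilter S) : Ultrafilter S :=
  U.bind fun s => V.map fun r => s * r

theorem mem_umul {S : Type*} [Semigroup S] {U V : Ultrafilter S} {B : Set S} :
    B ∈ umul U V ↔ {s | {r | s * r ∈ B} ∈ V} ∈ U :=
  Iff.rfl

theorem stmt_9 {S : Type*} [Semigroup S] (U V : Ultrafilter S) :
    UFinEmb1 {f : S → S | ∃ r : S, ∀ s : S, f s = s * r} U (umul U V) ∧
    UFinEmb1 {f : S → S | ∃ r : S, ∀ s : S, f s = r * s} V (umul U V) := by
  refine ⟨fun B hB => ⟨_, mem_umul.1 hB, fun G hG => ?_⟩, fun B hB => ?_⟩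
  · have h : (⋂ s ∈ G, {r | s * r ∈ B}) ∈ V :=
      (Filter.biInter_finset_mem G).2 fun s hs => hG hs
    obtain ⟨r, hr⟩ := V.nonempty_of_mem h
    exact ⟨fun s => s * r, ⟨r, fun _ => rfl⟩, fun s hs => Set.mem_iInter₂.1 hr s hs⟩
  · obtain ⟨s, hs⟩ := U.nonempty_of_mem (mem_umul.1 hB)
    exact ⟨_, hs, fun G hG => ⟨fun r => s * r, ⟨s, fun _ => rfl⟩, fun r hr => hG hr⟩⟩
end

section
/- Let S be a commutative monoid. Then there exists a maximal ultrafilter for ℱ_{(S,·)}-finite embeddability, i.e. an ultrafilter 𝒰 on S such that 𝒱 ≤_{ℱ_{(S,·)}} 𝒰 for every ultrafilter 𝒱 on S. -/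
/-- The family of translation maps of a commutative monoid. -/
abbrev translationMaps (S : Type*) [CommMonoid S] : Set (S → S) :=
  {f : S → S | ∃ r : S, ∀ s : S, f s = s * r}

theorem Ultrafilter.mem_bind_iff {ι S : Type*} {p : Ultrafilter ι} {W : ι → Ultrafilter S}
    {B : Set S} : B ∈ p.bind W ↔ {i | B ∈ W i} ∈ p :=
  Filter.mem_bind'

theorem FinEmb1.trans {S : Type*} [CommMonoid S] {A B C : Set S}
    (hAB : FinEmb1 (translationMaps S) A B) (hBC : FinEmb1 (translationMaps S) B C) :
    FinEmb1 (translationMaps S) A C := by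
  classical
  intro G hG
  obtain ⟨f, ⟨r, hr⟩, hf⟩ := hAB G hG
  obtain ⟨g, ⟨t, ht⟩, hg⟩ := hBC (G.image f) (by
    intro x hx
    obtain ⟨a, ha, rfl⟩ := Finset.mem_image.1 (Finset.mem_coe.1 hx)
    exact hf a ha)
  exact ⟨g ∘ f, ⟨r * t, fun s => by simp [hr, ht, mul_assoc]⟩,
    fun a ha => hg _ (Finset.mem_image_of_mem f ha)⟩

theorem UFinEmb1.trans {S : Type*} [CommMonoid S] {U V W : Ultrafilter S}
    (hUV : UFinEmb1 (translationMaps S) U V) (hVW : UFinEmb1 (translationMaps S) V W) :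
    UFinEmb1 (translationMaps S) U W := by
  intro C hC
  obtain ⟨B, hB, hBC⟩ := hVW C hC
  obtain ⟨A, hA, hAB⟩ := hUV B hB
  exact ⟨A, hA, hAB.trans hBC⟩

/-- The product of two ultrafilters is an upper bound of both for finite embeddability. -/
theorem exists_uFinEmb1_upperBound {S : Type*} [CommMonoid S] (U V : Ultrafilter S) :
    ∃ W : Ultrafilter S,
      UFinEmb1 (translationMaps S) U W ∧ UFinEmb1 (translationMaps S) V W := by
  refine ⟨U.bind fun s => V.map (s * ·), fun B hB => ?_, fun B hB => ?_⟩
  · refine ⟨_, Ultrafilter.mem_bind_iff.1 hB, fun G hG => ?_⟩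
    have h : (⋂ a ∈ G, (a * ·) ⁻¹' B) ∈ (V : Filter S) :=
      (Filter.biInter_finset_mem G).2 fun a ha => hG ha
    obtain ⟨t, ht⟩ := V.nonempty_of_mem h
    exact ⟨(· * t), ⟨t, fun _ => rfl⟩, fun a ha => Set.mem_iInter₂.1 ht a ha⟩
  · obtain ⟨s, hs⟩ := U.nonempty_of_mem (Ultrafilter.mem_bind_iff.1 hB)
    refine ⟨(s * ·) ⁻¹' B, hs, fun G hG => ⟨(· * s), ⟨s, fun _ => rfl⟩, fun a ha => ?_⟩⟩
    have h : s * a ∈ B := hG ha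
    simpa only [mul_comm a s] using h

theorem exists_uFinEmb1_finset_upperBound {S : Type*} [CommMonoid S]
    (F : Finset (Ultrafilter S)) :
    ∃ W : Ultrafilter S, ∀ V ∈ F, UFinEmb1 (translationMaps S) V W := by
  classical
  induction F using Finset.induction_on with
  | empty => exact ⟨pure 1, by simp⟩
  | insert U F _ ih =>
    obtain ⟨W, hW⟩ := ih
    obtain ⟨X, hUX, hWX⟩ := exists_uFinEmb1_upperBound U W
    refine ⟨X, fun V hV => ?_⟩
    rcases Finset.mem_insert.1 hV with rfl | hV
    · exact hUX
    · exact (hW V hV).trans hWX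

theorem stmt_10 {S : Type*} [CommMonoid S] :
    ∃ U : Ultrafilter S, ∀ V : Ultrafilter S,
      UFinEmb1 {f : S → S | ∃ r : S, ∀ s : S, f s = s * r} V U := by
  choose W hW using exists_uFinEmb1_finset_upperBound (S := S)
  let p : Ultrafilter (Finset (Ultrafilter S)) := Ultrafilter.of Filter.atTop
  refine ⟨p.bind W, fun V B hB => ?_⟩
  have hV : {F : Finset (Ultrafilter S) | V ∈ F} ∈ p :=
    Ultrafilter.of_le _ <| (Filter.eventually_ge_atTop {V}).mono
      fun _ hF => Finset.singleton_subset_iff.1 hF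
  obtain ⟨F, hBF, hVF⟩ := p.nonempty_of_mem (Filter.inter_mem (Ultrafilter.mem_bind_iff.1 hB) hV)
  exact hW F V hVF B hBF
end

section
/- Let S be a semigroup, let n ≥ 1 be a natural number, and let ℱ be a family of functions from Sⁿ to S. For every ultrafilter 𝒰 on S, the upper cone C_ℱ(𝒰) = {𝒱 : 𝒱 is an ultrafilter on S and 𝒰 ≤_ℱ 𝒱} is a closed subset of the space of ultrafilters on S equipped with the Stone topology (the topology whose basic open sets are {𝒱 : A ∈ 𝒱} for A ⊆ S). -/
/-- The upper cone of `U` is closed in the Stone topology on `Ultrafilter S`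
(the topology generated by the sets `{V | A ∈ V}` for `A ⊆ S`). -/
theorem stmt_11 {S : Type*} [Semigroup S] (n : ℕ) (hn : 1 ≤ n)
    (F : Set ((Fin n → S) → S)) (U : Ultrafilter S) :
    IsClosed {V : Ultrafilter S | UFinEmb n F U V} := by
  refine isClosed_of_closure_subset fun V hV B hB => ?_
  obtain ⟨W, hBW, hW⟩ := mem_closure_iff.mp hV _ (ultrafilter_isOpen_basic B) hB
  exact hW B hBW
end

section
/- Let S be a semigroup, let n ≥ 1 be a natural number, let ℱ be a family of functions from Sⁿ to S, and let P be a nonempty family of subsets of S that is ≤_ℱ-upward closed, i.e. for all A ∈ P and B ⊆ S, if A ≤_ℱ B then B ∈ P. Suppose P is partition regular and that there exists a maximal ultrafilter for ≤_ℱ. Then for every maximal ultrafilter 𝒰 (i.e. every 𝒰 with 𝒱 ≤_ℱ 𝒰 for all ultrafilters 𝒱), every set A ∈ 𝒰 belongs to P. -/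
/-- If every finite cover of `S` has a member in `P`, some ultrafilter is contained in `P`. -/
theorem exists_ultrafilter_forall_mem {S : Type*} (P : Set (Set S))
    (hpr : ∀ (m : ℕ) (C : Fin m → Set S), (⋃ i, C i) = Set.univ → ∃ i, C i ∈ P) :
    ∃ V : Ultrafilter S, ∀ A ∈ V, A ∈ P := by
  by_contra! h
  choose A hAV hAP using h
  obtain ⟨t, ht⟩ := isCompact_univ.elim_finite_subcover
    (fun V : Ultrafilter S => {W : Ultrafilter S | A V ∈ W})
    (fun V => ultrafilter_isOpen_basic (A V))
    (fun V _ => Set.mem_iUnion.2 ⟨V, hAV V⟩)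
  obtain ⟨i, hi⟩ := hpr t.card (fun i => A (t.equivFin.symm i)) <| by
    refine Set.eq_univ_of_forall fun x => ?_
    obtain ⟨V, hV, hx⟩ := Set.mem_iUnion₂.1 (ht (Set.mem_univ (pure x : Ultrafilter S)))
    refine Set.mem_iUnion.2 ⟨t.equivFin ⟨V, hV⟩, ?_⟩
    simpa using hx
  exact hAP _ hi

theorem stmt_15 {S : Type*} [Semigroup S] (n : ℕ) (hn : 1 ≤ n)
    (F : Set ((Fin n → S) → S)) (P : Set (Set S)) (hPne : P.Nonempty)
    (hup : ∀ A ∈ P, ∀ B : Set S, FinEmb n F A B → B ∈ P)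
    (hpr : ∀ (m : ℕ) (C : Fin m → Set S), (⋃ i, C i) = Set.univ → ∃ i, C i ∈ P)
    (hex : ∃ U : Ultrafilter S, ∀ V : Ultrafilter S, UFinEmb n F V U)
    (U : Ultrafilter S) (hU : ∀ V : Ultrafilter S, UFinEmb n F V U) :
    ∀ A ∈ U, A ∈ P := by
  intro B hB
  obtain ⟨V, hV⟩ := exists_ultrafilter_forall_mem P hpr
  obtain ⟨A, hAV, hAB⟩ := hU V B hB
  exact hup A (hV A hAV) B hAB
end

section
/- The family of AP-rich subsets of ℕ is strongly partition regular: if A ⊆ ℕ is AP-rich and A = A₁ ∪ … ∪ A_m is a finite partition of A, then there is an index i ≤ m such that Aᵢ is AP-rich. -/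
/-- `A ⊆ ℕ` is AP-rich: it contains arithmetic progressions of every finite length. -/
def APRich (A : Set ℕ) : Prop :=
  ∀ k : ℕ, ∃ a d : ℕ, 1 ≤ d ∧ ∀ j ≤ k, a + j * d ∈ A

/-- Along a combinatorial line, the sum of the coordinates is an affine function of the parameter
with positive slope. -/
theorem Combinatorics.Line.exists_sum_eq_add_mul {ι : Type*} [Fintype ι] {n : ℕ}
    (l : Combinatorics.Line (Fin n) ι) :
    ∃ b s : ℕ, 1 ≤ s ∧ ∀ x : Fin n, ∑ i, (l x i : ℕ) = b + (x : ℕ) * s := by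
  refine ⟨∑ i, (l.idxFun i).elim 0 Fin.val, ∑ i, (l.idxFun i).elim 1 fun _ => 0, ?_, fun x => ?_⟩
  · obtain ⟨i, hi⟩ := l.proper
    have h := Finset.single_le_sum (f := fun i => (l.idxFun i).elim 1 fun _ => 0)
      (fun _ _ => Nat.zero_le _) (Finset.mem_univ i)
    simpa [hi] using h
  · rw [Finset.mul_sum, ← Finset.sum_add_distrib]
    refine Finset.sum_congr rfl fun i _ => ?_
    rw [Combinatorics.Line.apply_def]
    cases h : l.idxFun i <;> simp [h]

/-- A finite form of van der Waerden's theorem: for every length `k` and number of colours `m`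
there is `N` such that any covering of `{0, …, N}` by `m` sets has a part containing a
progression of length `k + 1`. -/
theorem exists_forall_cover_exists_progression (k m : ℕ) :
    ∃ N : ℕ, ∀ P : Fin m → ℕ → Prop, (∀ n ≤ N, ∃ i, P i n) →
      ∃ i, ∃ b s : ℕ, 1 ≤ s ∧ ∀ j ≤ k, P i (b + j * s) := by
  obtain ⟨ι, _, hι⟩ :=
    Combinatorics.Line.exists_mono_in_high_dimension (Fin (k + 1)) (Fin m)
  refine ⟨Fintype.card ι * k, fun P hP => ?_⟩
  have hcover (v : ι → Fin (k + 1)) : ∃ i, P i (∑ t, (v t : ℕ)) := by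
    refine hP _ ?_
    simpa using Finset.sum_le_card_nsmul Finset.univ (fun t => (v t : ℕ)) k
      fun t _ => Nat.le_of_lt_succ (v t).isLt
  choose f hf using hcover
  obtain ⟨l, c, hl⟩ := hι f
  obtain ⟨b, s, hs, hsum⟩ := l.exists_sum_eq_add_mul
  refine ⟨c, b, s, hs, fun j hj => ?_⟩
  have h := hf (l ⟨j, Nat.lt_succ_of_le hj⟩)
  rwa [hl, hsum] at h

theorem stmt_16 (A : Set ℕ) (hA : APRich A) (m : ℕ) (C : Fin m → Set ℕ)
    (hC : (⋃ i, C i) = A) : ∃ i, APRich (C i) := by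
  by_contra! h
  simp only [APRich, not_forall] at h
  choose k hk using h
  obtain ⟨N, hN⟩ := exists_forall_cover_exists_progression (Finset.univ.sup k) m
  obtain ⟨a, d, hd, had⟩ := hA N
  obtain ⟨i, b, s, hs, hbs⟩ := hN (fun i n => a + n * d ∈ C i) fun n hn => by
    simpa [← hC] using had n hn
  refine hk i ⟨a + b * d, s * d, Nat.mul_pos hs hd, fun j hj => ?_⟩
  have hmem := hbs j (hj.trans (Finset.le_sup (Finset.mem_univ i)))
  rwa [show a + b * d + j * (s * d) = a + (b + j * s) * d by ring]
end

section
/- Let A, B ⊆ ℕ and suppose A is GAP-rich. If A is ℱ-finitely embeddable in B, where ℱ = {x ↦ x·m : m ∈ ℕ, m ≥ 1} is the family of multiplications by positive naturals (i.e. for every finite subset F of A there exists m ≥ 1 with m·F ⊆ B), then B is GAP-rich. -/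
/-- `A ⊆ ℕ` is GAP-rich: it contains arbitrarily long geoarithmetic progressions. -/
def GAPRich (A : Set ℕ) : Prop :=
  ∀ k : ℕ, ∃ r b a : ℕ, 1 < r ∧ 0 < b ∧
    ∀ i j : ℕ, 1 ≤ i → i ≤ k → 1 ≤ j → j ≤ k → r ^ i * (a + j * b) ∈ A

theorem stmt_17 (A B : Set ℕ) (hA : GAPRich A)
    (h : ∀ G : Finset ℕ, ↑G ⊆ A → ∃ m : ℕ, 1 ≤ m ∧ ∀ x ∈ G, x * m ∈ B) :
    GAPRich B := by
  intro k
  obtain ⟨r, b, a, hr, hb, hA⟩ := hA k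
  obtain ⟨m, hm, hB⟩ := h
    ((Finset.Icc 1 k ×ˢ Finset.Icc 1 k).image fun p => r ^ p.1 * (a + p.2 * b)) (by
      intro x hx
      simp only [Finset.coe_image, Set.mem_image, Finset.mem_coe, Finset.mem_product,
        Finset.mem_Icc] at hx
      obtain ⟨p, ⟨⟨hi, hik⟩, hj, hjk⟩, rfl⟩ := hx
      exact hA p.1 p.2 hi hik hj hjk)
  refine ⟨r, b * m, a * m, hr, Nat.mul_pos hb hm, fun i j hi hik hj hjk => ?_⟩
  have hmem := hB (r ^ i * (a + j * b)) (Finset.mem_image.2 ⟨(i, j), by simp [*], rfl⟩)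
  convert hmem using 1
  ring
end

section
/- The family of GAP-rich subsets of ℕ is strongly partition regular: if A ⊆ ℕ is GAP-rich and A = A₁ ∪ … ∪ A_m is a finite partition of A, then there is an index i ≤ m such that Aᵢ is GAP-rich. -/
/-- Along a combinatorial line, the coordinate sum of any additive weight is affine in the
parameter, with slope the number of active coordinates. -/
theorem line_sum_eq {α ι : Type*} [Fintype ι] (l : Combinatorics.Line α ι) (f : α → ℕ) (x : α) :
    ∑ i, f (l x i) = ∑ i, ((l.idxFun i).map f).getD 0 +
      (Finset.univ.filter fun i => l.idxFun i = none).card * f x := by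
  rw [Finset.card_filter, Finset.sum_mul, ← Finset.sum_add_distrib]
  refine Finset.sum_congr rfl fun i _ => ?_
  cases h : l.idxFun i <;> simp [h]

theorem exists_color_contains_gap {A : Set ℕ} (hA : GAPRich A) {m : ℕ} {C : Fin m → Set ℕ}
    (hC : A ⊆ ⋃ i, C i) (k : ℕ) :
    ∃ c, ∃ r b a : ℕ, 1 < r ∧ 0 < b ∧
      ∀ i j : ℕ, 1 ≤ i → i ≤ k → 1 ≤ j → j ≤ k → r ^ i * (a + j * b) ∈ C c := by
  obtain ⟨ι, _, hι⟩ := Combinatorics.Line.exists_mono_in_high_dimension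
    (Fin (k + 1) × Fin (k + 1)) (Fin m)
  obtain ⟨r, b, a, hr, hb, hmem⟩ := hA (1 + Fintype.card ι * k)
  have sum_le (g : ι → Fin (k + 1)) : ∑ t, (g t : ℕ) ≤ Fintype.card ι * k := by
    simpa using Finset.sum_le_card_nsmul Finset.univ (fun t => (g t : ℕ)) k
      fun t _ => Nat.le_of_lt_succ (g t).isLt
  have hcol (w : ι → Fin (k + 1) × Fin (k + 1)) :
      ∃ c, r ^ (1 + ∑ t, ((w t).1 : ℕ)) * (a + (1 + ∑ t, ((w t).2 : ℕ)) * b) ∈ C c :=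
    Set.mem_iUnion.1 <| hC <| hmem _ _ (Nat.le_add_right _ _)
      (Nat.add_le_add_left (sum_le fun t => (w t).1) 1) (Nat.le_add_right _ _)
      (Nat.add_le_add_left (sum_le fun t => (w t).2) 1)
  choose col hcol using hcol
  obtain ⟨l, c, hl⟩ := hι col
  set d := (Finset.univ.filter fun t => l.idxFun t = none).card with hd
  have hdpos : 0 < d := by
    obtain ⟨t, ht⟩ := l.proper
    exact Finset.card_pos.2 ⟨t, by simpa using ht⟩
  set s := ∑ t, ((l.idxFun t).map fun p => (p.1 : ℕ)).getD 0
  set u := ∑ t, ((l.idxFun t).map fun p => (p.2 : ℕ)).getD 0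
  refine ⟨c, r ^ d, r ^ (1 + s) * (d * b), r ^ (1 + s) * (a + (1 + u) * b),
    Nat.one_lt_pow hdpos.ne' hr, by positivity, fun i j _ hi _ hj => ?_⟩
  have h := hcol (l (⟨i, Nat.lt_succ_of_le hi⟩, ⟨j, Nat.lt_succ_of_le hj⟩))
  rw [hl, line_sum_eq l (fun p => (p.1 : ℕ)), line_sum_eq l (fun p => (p.2 : ℕ))] at h
  convert h using 1
  simp only [← hd]
  ring

theorem stmt_18 (A : Set ℕ) (hA : GAPRich A) (m : ℕ) (C : Fin m → Set ℕ)
    (hC : (⋃ i, C i) = A) : ∃ i, GAPRich (C i) := by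
  by_contra! hcon
  simp only [GAPRich, not_forall] at hcon
  choose k hk using hcon
  obtain ⟨c, r, b, a, hr, hb, h⟩ := exists_color_contains_gap hA hC.ge (Finset.univ.sup k)
  have hle : k c ≤ Finset.univ.sup k := Finset.le_sup (Finset.mem_univ c)
  exact hk c ⟨r, b, a, hr, hb, fun i j hi hik hj hjk =>
    h i j hi (hik.trans hle) hj (hjk.trans hle)⟩
end

section
/- Let P(x₁,…,xₙ) be a homogeneous polynomial with integer coefficients in n variables. The following are equivalent: (i) the equation P(x₁,…,xₙ) = 0 is partition regular over the positive integers, i.e. for every finite partition of the positive integers into cells A₁, …, A_m there is an index i and positive integers a₁, …, aₙ ∈ Aᵢ with P(a₁,…,aₙ) = 0; (ii) every subset A of the positive integers that is piecewise syndetic in the multiplicative semigroup of positive integers contains elements a₁, …, aₙ with P(a₁,…,aₙ) = 0. -/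
/-- `T` is thick in the multiplicative semigroup of positive integers. -/
def ThickPNat (T : Set ℕ+) : Prop :=
  ∀ G : Finset ℕ+, ∃ s : ℕ+, ∀ t ∈ G, t * s ∈ T

/-- `A` is piecewise syndetic in the multiplicative semigroup of positive integers. -/
def PiecewiseSyndeticPNat (A : Set ℕ+) : Prop :=
  ∃ G : Finset ℕ+, ThickPNat {s : ℕ+ | ∃ t ∈ G, t * s ∈ A}

/-- Removing a set that is not piecewise syndetic from a thick set leaves a thick set. -/
theorem ThickPNat.diff {T A : Set ℕ+} (hT : ThickPNat T) (hA : ¬ PiecewiseSyndeticPNat A) :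
    ThickPNat (T \ A) := by
  classical
  intro G
  have hG : ¬ ThickPNat {s : ℕ+ | ∃ t ∈ G, t * s ∈ A} := fun h => hA ⟨G, h⟩
  simp only [ThickPNat, Set.mem_ofPred_eq] at hG
  push Not at hG
  obtain ⟨F, hF⟩ := hG
  obtain ⟨s, hs⟩ := hT (Finset.image₂ (· * ·) G F)
  obtain ⟨f, hf, hfs⟩ := hF s
  refine ⟨f * s, fun t ht => ⟨?_, hfs t ht⟩⟩
  rw [← mul_assoc]
  exact hs _ (Finset.mem_image₂_of_mem ht hf)

theorem ThickPNat.nonempty {T : Set ℕ+} (hT : ThickPNat T) : T.Nonempty := by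
  obtain ⟨s, hs⟩ := hT {1}
  exact ⟨1 * s, hs 1 (Finset.mem_singleton_self 1)⟩

/-- Some cell of every finite cover of the positive integers is piecewise syndetic. -/
theorem exists_piecewiseSyndeticPNat_of_iUnion_eq_univ {ι : Type*} [Finite ι] {C : ι → Set ℕ+}
    (hC : (⋃ i, C i) = Set.univ) : ∃ i, PiecewiseSyndeticPNat (C i) := by
  classical
  by_contra! h
  have hthick : ∀ I : Finset ι, ThickPNat (⋃ i ∈ I, C i)ᶜ := by
    intro I
    induction I using Finset.induction_on with
    | empty => exact fun G => ⟨1, by simp⟩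
    | insert i I _ ih =>
      convert ih.diff (h i) using 1
      rw [Finset.set_biUnion_insert, Set.compl_union, Set.inter_comm, Set.sdiff_eq]
  cases nonempty_fintype ι
  simpa [hC] using (hthick Finset.univ).nonempty

/-- A piecewise syndetic set induces a finite cover of the positive integers such that every
finite subset of a cell can be dilated into the set. -/
theorem PiecewiseSyndeticPNat.exists_cover {A : Set ℕ+} (hA : PiecewiseSyndeticPNat A) :
    ∃ (m : ℕ) (C : Fin m → Set ℕ+), (⋃ i, C i) = Set.univ ∧
      ∀ (i : Fin m) (F : Set ℕ+), F.Finite → F ⊆ C i → ∃ s : ℕ+, ∀ x ∈ F, s * x ∈ A := by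
  classical
  obtain ⟨G, hG⟩ := hA
  choose s hs using hG
  let U : Ultrafilter (Finset ℕ+) := Ultrafilter.of Filter.atTop
  let C : G → Set ℕ+ := fun t => {x | ∀ᶠ F in U, t * (x * s F) ∈ A}
  refine ⟨G.card, fun i => C (G.equivFin.symm i), ?_, fun i F hF hFC => ?_⟩
  · refine Set.eq_univ_of_forall fun x => ?_
    have hx : ∀ᶠ F in U, ∃ t ∈ (G : Set ℕ+), t * (x * s F) ∈ A :=
      ((Filter.eventually_ge_atTop {x}).filter_mono (Ultrafilter.of_le _)).mono
        fun F hF => hs F x (Finset.singleton_subset_iff.mp hF)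
    obtain ⟨t, ht, htU⟩ := (Ultrafilter.eventually_exists_mem_iff G.finite_toSet).mp hx
    refine Set.mem_iUnion.mpr ⟨G.equivFin ⟨t, ht⟩, ?_⟩
    rw [Equiv.symm_apply_apply]
    exact htU
  · obtain ⟨H, hH⟩ := ((Filter.eventually_all_finite hF).mpr fun x hx => hFC hx).exists
    refine ⟨G.equivFin.symm i * s H, fun x hx => ?_⟩
    rw [mul_assoc, mul_comm (s H)]
    exact hH x hx

/-- A homogeneous polynomial of degree `d` scales by `c ^ d` when its arguments scale by `c`. -/
theorem MvPolynomial.IsHomogeneous.eval_const_mul {σ R : Type*} [CommSemiring R]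
    {P : MvPolynomial σ R} {d : ℕ} (hP : P.IsHomogeneous d) (c : R) (x : σ → R) :
    MvPolynomial.eval (fun j => c * x j) P = c ^ d * MvPolynomial.eval x P := by
  rw [MvPolynomial.eval_eq, MvPolynomial.eval_eq, Finset.mul_sum]
  refine Finset.sum_congr rfl fun e he => ?_
  have hd : ∑ i ∈ e.support, e i = d := by
    simpa [Finsupp.weight_apply, Finsupp.sum] using hP (MvPolynomial.mem_support_iff.mp he)
  rw [← hd]
  simp only [mul_pow, Finset.prod_mul_distrib, Finset.prod_pow_eq_pow_sum]
  ring

theorem stmt_19 (n : ℕ) (P : MvPolynomial (Fin n) ℤ) (d : ℕ)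
    (hP : P.IsHomogeneous d) :
    (∀ (m : ℕ) (C : Fin m → Set ℕ+), (⋃ i, C i) = Set.univ →
      ∃ i, ∃ a : Fin n → ℕ+, (∀ j, a j ∈ C i) ∧
        MvPolynomial.eval (fun j => ((a j : ℕ) : ℤ)) P = 0) ↔
    (∀ A : Set ℕ+, PiecewiseSyndeticPNat A →
      ∃ a : Fin n → ℕ+, (∀ j, a j ∈ A) ∧
        MvPolynomial.eval (fun j => ((a j : ℕ) : ℤ)) P = 0) := by
  constructor
  · intro h A hA
    obtain ⟨m, C, hC, hdil⟩ := hA.exists_cover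
    obtain ⟨i, a, ha, hPa⟩ := h m C hC
    obtain ⟨s, hs⟩ := hdil i (Set.range a) (Set.finite_range a) (Set.range_subset_iff.mpr ha)
    refine ⟨fun j => s * a j, fun j => hs _ (Set.mem_range_self j), ?_⟩
    simp only [PNat.mul_coe, Nat.cast_mul]
    rw [hP.eval_const_mul, hPa, mul_zero]
  · intro h m C hC
    obtain ⟨i, hi⟩ := exists_piecewiseSyndeticPNat_of_iUnion_eq_univ hC
    exact ⟨i, h (C i) hi⟩
end
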